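/- Assume the Generalized Riemann Hypothesis: for every Dirichlet character χ, every zero of the Dirichlet L-function L(s,χ) with 0 < Re(s) < 1 has Re(s) = 1/2. Then for every ε > 0 there is a constant C = C(ε) such that for every integer q ≥ 2, every integer t, and every real z ≥ 1, | Σ_{n ≤ z, gcd(n,q)=1} μ(n)·e(t·n̄_q/q) | ≤ C·z^{3/4+ε}·q^{1/2}·τ(q)², where n̄_q denotes an integer with n·n̄_q ≡ 1 (mod q) and τ(q) is the number of positive divisors of q. -/

import Mathlib

open Finset Filter

/-- `e(x) = exp(2πix)`. -/
noncomputable def eFun (x : ℝ) : ℂ := Complex.exp (2 * Real.pi * Complex.I * x)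

/-- Interpolation between a small and a large circle, in additive form. -/
theorem norm_le_of_norm_le_two_spheres {g : ℂ → ℂ} {R r₀ r₁ r A B : ℝ}
    (hg : DifferentiableOn ℂ g (Metric.ball 0 R)) (hr₀ : 0 < r₀) (hr₀R : r₀ < R)
    (hr : 0 ≤ r) (hrr : r < r₁) (hr₁R : r₁ < R)
    (hB : ∀ z ∈ Metric.sphere (0 : ℂ) r₀, ‖g z‖ ≤ B)
    (hA : ∀ z ∈ Metric.sphere (0 : ℂ) r₁, ‖g z‖ ≤ A) (N : ℕ) {z : ℂ} (hz : ‖z‖ ≤ r) :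
    ‖g z‖ ≤ B * ∑ n ∈ Finset.range N, (r / r₀) ^ n + A * (r / r₁) ^ N * (1 - r / r₁)⁻¹ := by
  have hr₁ : 0 < r₁ := hr.trans_lt hrr
  have hcoef : ∀ ρ D : ℝ, 0 < ρ → ρ < R → (∀ z ∈ Metric.sphere (0 : ℂ) ρ, ‖g z‖ ≤ D) →
      ∀ n : ℕ, ‖(n.factorial : ℂ)⁻¹ • (z - 0) ^ n • iteratedDeriv n g 0‖ ≤ D * (r / ρ) ^ n := by
    intro ρ D hρ hρR hD n
    have h := Complex.norm_iteratedDeriv_le_of_forall_mem_sphere_norm_le n hρ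
      (hg.diffContOnCl_ball (Metric.closedBall_subset_ball hρR)) hD
    have hD0 : 0 ≤ D := (norm_nonneg _).trans (hD (ρ : ℂ) (by simp [abs_of_pos hρ]))
    rw [norm_smul, norm_smul, norm_inv, Complex.norm_natCast, sub_zero, norm_pow, div_pow]
    have hf : (0 : ℝ) < n.factorial := by exact_mod_cast n.factorial_pos
    calc _ ≤ (n.factorial : ℝ)⁻¹ * (r ^ n * (n.factorial * D / ρ ^ n)) := by gcongr
      _ = _ := by field_simp
  have hs := Complex.hasSum_taylorSeries_on_ball hg (z := z)
    (by simpa using hz.trans_lt (hrr.trans hr₁R))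
  have hq : r / r₁ < 1 := (div_lt_one hr₁).2 hrr
  have hq0 : 0 ≤ r / r₁ := by positivity
  have htail : HasSum (fun n : ℕ => A * (r / r₁) ^ (n + N))
      (A * (r / r₁) ^ N * (1 - r / r₁)⁻¹) := by
    simpa only [pow_add, mul_assoc, mul_comm, mul_left_comm] using
      (hasSum_geometric_of_lt_one hq0 hq).mul_left (A * (r / r₁) ^ N)
  rw [← hs.tsum_eq, ← hs.summable.sum_add_tsum_nat_add N, Finset.mul_sum]
  refine (norm_add_le _ _).trans (add_le_add ?_ ?_)
  · exact (norm_sum_le _ _).trans (Finset.sum_le_sum fun n _ => hcoef r₀ B hr₀ hr₀R hB n)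
  · exact tsum_of_norm_bounded htail fun n => hcoef r₁ A hr₁ hr₁R hA (n + N)

/-- A nonvanishing holomorphic function on a disc has a holomorphic logarithm. -/
theorem exists_log_on_ball {f : ℂ → ℂ} {R : ℝ} (hR : 0 < R)
    (hf : DifferentiableOn ℂ f (Metric.ball 0 R)) (hf0 : ∀ z ∈ Metric.ball (0 : ℂ) R, f z ≠ 0) :
    ∃ g : ℂ → ℂ, DifferentiableOn ℂ g (Metric.ball 0 R) ∧
      (∀ z ∈ Metric.ball (0 : ℂ) R, Complex.exp (g z) = f z) ∧ g 0 = Complex.log (f 0) := by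
  have h0 : (0 : ℂ) ∈ Metric.ball (0 : ℂ) R := by simpa
  obtain ⟨G, hG⟩ := ((hf.deriv Metric.isOpen_ball).div hf hf0).isExactOn_ball
  refine ⟨fun z => G z - G 0 + Complex.log (f 0), ?_, ?_, by simp⟩
  · exact fun z hz => ((hG z hz).differentiableAt.sub_const _ |>.add_const _).differentiableWithinAt
  · intro z hz
    have hd : ∀ w ∈ Metric.ball (0 : ℂ) R, HasDerivAt
        (fun w => Complex.exp (-(G w - G 0 + Complex.log (f 0))) * f w) 0 w := by
      intro w hw
      have h1 := ((((hG w hw).sub_const (G 0)).add_const (Complex.log (f 0))).neg.cexp).mul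
        (hf.differentiableAt (Metric.isOpen_ball.mem_nhds hw)).hasDerivAt
      have hz0 : Complex.exp (-(G w - G 0 + Complex.log (f 0))) * -(deriv f w / f w) * f w +
          Complex.exp (-(G w - G 0 + Complex.log (f 0))) * deriv f w = 0 := by
        have := hf0 w hw
        field_simp
        ring
      exact h1.congr_deriv hz0
    have hc := (convex_ball (0 : ℂ) R).is_const_of_fderivWithin_eq_zero (𝕜 := ℂ)
      (f := fun w => Complex.exp (-(G w - G 0 + Complex.log (f 0))) * f w)
      (fun w hw => (hd w hw).differentiableAt.differentiableWithinAt)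
      (fun w hw => by
        rw [fderivWithin_of_isOpen Metric.isOpen_ball hw]
        have := (hd w hw).hasFDerivAt.fderiv
        rw [this]; ext; simp) hz h0
    simp only [sub_self, zero_add, Complex.exp_neg, Complex.exp_log (hf0 0 h0)] at hc
    rw [inv_mul_cancel₀ (hf0 0 h0), inv_mul_eq_one₀ (Complex.exp_ne_zero _)] at hc
    exact hc

/-- A holomorphic function without zeros on a disc that is bounded above and below near the
center has a reciprocal growing slower than any power of its supremum. -/
theorem exists_norm_inv_le_rpow {R r r₀ K ε : ℝ} (hr₀ : 0 < r₀) (hr₀R : r₀ ≤ R) (hr : 0 ≤ r)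
    (hrR : r < R) (hK : 1 ≤ K) (hε : 0 < ε) :
    ∃ C : ℝ, 0 < C ∧ ∀ (f : ℂ → ℂ) (c : ℂ) (M : ℝ), 1 ≤ M →
      DifferentiableOn ℂ f (Metric.ball c R) → (∀ z ∈ Metric.ball c R, f z ≠ 0) →
      (∀ z ∈ Metric.ball c R, ‖f z‖ ≤ M) →
      (∀ z ∈ Metric.ball c r₀, ‖f z‖ ≤ K) → ‖(f c)⁻¹‖ ≤ K →
      ∀ z, ‖z - c‖ ≤ r → ‖(f z)⁻¹‖ ≤ C * M ^ ε := by
  have hR : 0 < R := hr₀.trans_le hr₀R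
  obtain ⟨r₁, hrr₁, hr₁R⟩ := exists_between hrR
  have hr₁ : 0 < r₁ := hr.trans_lt hrr₁
  have hlogK := Real.log_nonneg hK
  set G := Real.log K + Real.pi with hG
  have hGpos : 0 < G := by positivity
  have hq0 : 0 ≤ r / r₁ := by positivity
  have hq1 : r / r₁ < 1 := (div_lt_one hr₁).2 hrr₁
  set B := 2 * G * (r₀ / 2) / (r₀ - r₀ / 2) + G * (r₀ + r₀ / 2) / (r₀ - r₀ / 2) with hB
  set α := 2 * r₁ / (R - r₁) with hα
  set β := 2 * r₁ / (R - r₁) + G * (R + r₁) / (R - r₁) with hβ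
  have hRr : 0 < R - r₁ := by linarith
  have hαpos : 0 < α := by positivity
  obtain ⟨N, hN⟩ : ∃ N : ℕ, (r / r₁) ^ N < ε / (α * (1 - r / r₁)⁻¹) :=
    exists_pow_lt_of_lt_one (by have : 0 < 1 - r / r₁ := by linarith
                                positivity) hq1
  have hq : 0 < 1 - r / r₁ := by linarith
  set D := B * ∑ n ∈ Finset.range N, (r / (r₀ / 2)) ^ n + β * (r / r₁) ^ N * (1 - r / r₁)⁻¹ with hD
  refine ⟨Real.exp D, Real.exp_pos _, fun f c M hM hf hf0 hfM hfK hfc z hz => ?_⟩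
  have hlogM := Real.log_nonneg hM
  have hmap : ∀ ρ : ℝ, ∀ w ∈ Metric.ball (0 : ℂ) ρ, w + c ∈ Metric.ball c ρ := by
    intro ρ w hw; simpa [dist_eq_norm] using hw
  obtain ⟨g, hgd, hge, hg0⟩ := exists_log_on_ball (f := fun w => f (w + c)) hR
    (hf.comp (by fun_prop) (hmap R)) (fun w hw => hf0 _ (hmap R w hw))
  have hre : ∀ w ∈ Metric.ball (0 : ℂ) R, (g w).re = Real.log ‖f (w + c)‖ := by
    intro w hw
    rw [← hge w hw, Complex.norm_exp, Real.log_exp]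
  have hsub : Metric.ball (0 : ℂ) r₀ ⊆ Metric.ball 0 R := Metric.ball_subset_ball hr₀R
  have hcR : c ∈ Metric.ball c R := by simpa
  have hpos : ∀ w ∈ Metric.ball (0 : ℂ) R, 0 < ‖f (w + c)‖ := fun w hw =>
    norm_pos_iff.2 (hf0 _ (hmap R w hw))
  have hg0' : ‖g 0‖ ≤ G := by
    rw [hg0, zero_add]
    have h1 : |Real.log ‖f c‖| ≤ Real.log K := by
      have hp : 0 < ‖f c‖ := norm_pos_iff.2 (hf0 c hcR)
      rw [abs_le]
      constructor
      · rw [← Real.log_inv]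
        refine Real.log_le_log (by positivity) ?_
        rw [norm_inv] at hfc
        exact inv_le_of_inv_le₀ hp hfc
      · exact Real.log_le_log hp (hfK c (by simpa))
    calc ‖Complex.log (f c)‖ ≤ |(Complex.log (f c)).re| + |(Complex.log (f c)).im| :=
          Complex.norm_le_abs_re_add_abs_im _
      _ ≤ G := by
        rw [Complex.log_re, Complex.log_im]
        exact add_le_add h1 (Complex.abs_arg_le_pi _)
  have hsmall : ∀ w ∈ Metric.sphere (0 : ℂ) (r₀ / 2), ‖g w‖ ≤ B := by
    intro w hw
    have hw' : ‖w‖ = r₀ / 2 := by simpa using hw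
    have := Complex.borelCaratheodory (M := G) hGpos (hgd.mono hsub) (z := w) (fun x hx => by
      have := hre x (hsub hx)
      simp only [Set.mem_ofPred_eq]
      rw [this]
      refine (Real.log_le_log (hpos x (hsub hx)) (hfK _ (hmap r₀ x hx))).trans ?_
      linarith [Real.pi_pos]) hr₀ (by simp [hw']; linarith)
    rw [hw'] at this
    refine this.trans ?_
    have : 0 < r₀ - r₀ / 2 := by linarith
    rw [hB]; gcongr
  have hlarge : ∀ w ∈ Metric.sphere (0 : ℂ) r₁, ‖g w‖ ≤ α * Real.log M + β := by
    intro w hw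
    have hw' : ‖w‖ = r₁ := by simpa using hw
    have := Complex.borelCaratheodory (M := Real.log M + 1) (by linarith) hgd (z := w)
      (fun x hx => by
        have := hre x hx
        simp only [Set.mem_ofPred_eq]
        rw [this]
        refine (Real.log_le_log (hpos x hx) (hfM _ (hmap R x hx))).trans ?_
        linarith) hR (by simp [hw']; linarith)
    rw [hw'] at this
    refine this.trans ?_
    have : ‖g 0‖ * (R + r₁) / (R - r₁) ≤ G * (R + r₁) / (R - r₁) := by gcongr
    have h2 : 2 * (Real.log M + 1) * r₁ / (R - r₁) = α * Real.log M + 2 * r₁ / (R - r₁) := by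
      rw [hα]; ring
    rw [hβ]; linarith
  have hmain := norm_le_of_norm_le_two_spheres hgd (by positivity : 0 < r₀ / 2) (by linarith) hr
    hrr₁ hr₁R hsmall hlarge N hz
  have hzR : z - c ∈ Metric.ball (0 : ℂ) R := by simpa using hz.trans_lt hrR
  have hge' := hge _ hzR
  simp only [sub_add_cancel] at hge'
  rw [← hge', ← Complex.exp_neg, Complex.norm_exp, Complex.neg_re,
    Real.rpow_def_of_pos (by linarith),
    ← Real.exp_add, Real.exp_le_exp]
  have hN' : α * (r / r₁) ^ N * (1 - r / r₁)⁻¹ ≤ ε := by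
    rw [lt_div_iff₀ (by positivity)] at hN
    linarith
  calc -(g (z - c)).re ≤ ‖g (z - c)‖ := (neg_le_abs _).trans (Complex.abs_re_le_norm _)
    _ ≤ _ := hmain
    _ = D + Real.log M * (α * (r / r₁) ^ N * (1 - r / r₁)⁻¹) := by rw [hD]; ring
    _ ≤ _ := by gcongr

/-- The partial sums of a Dirichlet character are linear up to a bounded error. -/
theorem DirichletCharacter.norm_sum_Icc_sub_mul_le {N : ℕ} [NeZero N]
    (χ : DirichletCharacter ℂ N) (n : ℕ) :
    ‖∑ k ∈ Icc 1 n, χ k - (∑ k ∈ Icc 1 N, χ k) / N * n‖ ≤ 2 * N := by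
  set c : ℂ := (∑ k ∈ Icc 1 N, χ k) / N with hc
  have hN : (N : ℂ) ≠ 0 := NeZero.ne _
  have hN' : 0 < N := NeZero.pos N
  have hbound : ∀ m : ℕ, ‖∑ k ∈ Icc 1 m, χ k‖ ≤ m := fun m => by
    simpa using norm_sum_le_of_le (Icc 1 m) (f := fun k : ℕ => χ k) (n := fun _ => (1 : ℝ))
      fun k _ => χ.norm_le_one _
  have hsplit : ∀ m : ℕ, ∑ k ∈ Icc 1 (m + N), χ k = ∑ k ∈ Icc 1 m, χ k + ∑ k ∈ Icc 1 N, χ k := by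
    intro m
    induction m with
    | zero => simp
    | succ m ih =>
      rw [show m + 1 + N = (m + N) + 1 by ring, sum_Icc_succ_top (by omega), ih,
        sum_Icc_succ_top (by omega)]
      simp
      ring
  have hper : Function.Periodic (fun n : ℕ => ∑ k ∈ Icc 1 n, χ k - c * n) N := by
    intro m
    simp only [hsplit m, hc]
    push_cast
    field_simp
    ring
  have h := hper.map_mod_nat n
  rw [← h]
  have hc1 : ‖c‖ ≤ 1 := by
    rw [hc, norm_div, Complex.norm_natCast, div_le_one (by exact_mod_cast hN')]
    exact hbound N
  have hm : ((n % N : ℕ) : ℝ) ≤ N := by exact_mod_cast (Nat.mod_lt n hN').le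
  calc _ ≤ ‖∑ k ∈ Icc 1 (n % N), χ k‖ + ‖c * (n % N : ℕ)‖ := norm_sub_le _ _
    _ ≤ (n % N : ℕ) + 1 * (n % N : ℕ) := by
      rw [norm_mul, Complex.norm_natCast]
      gcongr
      exact hbound _
    _ ≤ _ := by linarith

/-- The error in the linear approximation to the partial sums of `χ`, cut off below `1`. -/
noncomputable def charSumError {N : ℕ} (χ : DirichletCharacter ℂ N) (x : ℝ) : ℂ :=
  (Set.Ioi 1).indicator
    (fun x : ℝ => ∑ k ∈ Icc 1 ⌊x⌋₊, χ k - (∑ k ∈ Icc 1 N, χ k) / N * x) x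

theorem norm_mean_dirichletCharacter_le_one {N : ℕ} [NeZero N] (χ : DirichletCharacter ℂ N) :
    ‖(∑ k ∈ Icc 1 N, χ k) / N‖ ≤ 1 := by
  have hN' : 0 < N := NeZero.pos N
  rw [norm_div, Complex.norm_natCast, div_le_one (by exact_mod_cast hN')]
  simpa using norm_sum_le_of_le (Icc 1 N) (f := fun k : ℕ => χ k) (n := fun _ => (1 : ℝ))
      fun k _ => χ.norm_le_one _

theorem norm_charSumError_le {N : ℕ} [NeZero N] (χ : DirichletCharacter ℂ N) (x : ℝ) :
    ‖charSumError χ x‖ ≤ 3 * N := by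
  have hN : (1 : ℝ) ≤ N := by exact_mod_cast NeZero.pos N
  unfold charSumError
  by_cases hx : x ∈ Set.Ioi 1
  · rw [Set.indicator_of_mem hx]
    have hx0 : (0 : ℝ) ≤ x := (zero_lt_one.trans hx).le
    have h1 := χ.norm_sum_Icc_sub_mul_le ⌊x⌋₊
    have h2 : ‖((x : ℂ) - (⌊x⌋₊ : ℕ))‖ ≤ 1 := by
      rw [← Complex.ofReal_natCast, ← Complex.ofReal_sub, Complex.norm_real, Real.norm_eq_abs,
        abs_le]
      constructor <;> linarith [Nat.floor_le hx0, Nat.lt_floor_add_one x]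
    calc _ = ‖(∑ k ∈ Icc 1 ⌊x⌋₊, χ k - (∑ k ∈ Icc 1 N, χ k) / N * ⌊x⌋₊) -
          (∑ k ∈ Icc 1 N, χ k) / N * (x - ⌊x⌋₊)‖ := by ring_nf
      _ ≤ 2 * N + 1 * 1 := by
        refine (norm_sub_le _ _).trans (add_le_add h1 ?_)
        rw [norm_mul]
        exact mul_le_mul (norm_mean_dirichletCharacter_le_one χ) h2 (norm_nonneg _) zero_le_one
      _ ≤ _ := by linarith
  · rw [Set.indicator_of_notMem hx, norm_zero]; positivity

theorem measurable_charSumError {N : ℕ} (χ : DirichletCharacter ℂ N) :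
    Measurable (charSumError χ) := by
  refine Measurable.indicator (Measurable.sub ?_ (by fun_prop)) measurableSet_Ioi
  exact (measurable_from_top (f := fun n : ℕ => ∑ k ∈ Icc 1 n, χ k)).comp Nat.measurable_floor

theorem locallyIntegrableOn_charSumError {N : ℕ} [NeZero N] (χ : DirichletCharacter ℂ N) :
    MeasureTheory.LocallyIntegrableOn (charSumError χ) (Set.Ioi 0) := by
  refine (MeasureTheory.LocallyIntegrable.mono (f := fun _ : ℝ => (3 * N : ℝ))
    (MeasureTheory.locallyIntegrable_const _) (measurable_charSumError χ).aestronglyMeasurable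
    (Eventually.of_forall fun x => ?_)).locallyIntegrableOn _
  exact (norm_charSumError_le χ x).trans (le_abs_self _)

theorem charSumError_isBigO_atTop {N : ℕ} [NeZero N] (χ : DirichletCharacter ℂ N) :
    charSumError χ =O[atTop] (fun x : ℝ => x ^ (-(0 : ℝ))) :=
  Asymptotics.IsBigO.of_bound (3 * N) (Eventually.of_forall fun x => by
    simpa using norm_charSumError_le χ x)

theorem charSumError_isBigO_zero {N : ℕ} [NeZero N] (χ : DirichletCharacter ℂ N) (b : ℝ) :
    charSumError χ =O[nhdsWithin 0 (Set.Ioi 0)] (fun x : ℝ => x ^ (-b)) := by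
  refine Asymptotics.IsBigO.of_bound 0 ?_
  filter_upwards [mem_nhdsWithin_of_mem_nhds (Iio_mem_nhds (zero_lt_one (α := ℝ)))] with x hx
  have hx' : x ≤ 1 := le_of_lt (Set.mem_Iio.1 hx)
  simp [charSumError, hx']

theorem differentiableAt_mellin_charSumError {N : ℕ} [NeZero N]
    (χ : DirichletCharacter ℂ N) {s : ℂ} (hs : s.re < 0) :
    DifferentiableAt ℂ (mellin (charSumError χ)) s :=
  mellin_differentiableAt_of_isBigO_rpow (locallyIntegrableOn_charSumError χ)
    (charSumError_isBigO_atTop χ) hs (charSumError_isBigO_zero χ (s.re - 1)) (by linarith)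

theorem mellin_charSumError {N : ℕ} (χ : DirichletCharacter ℂ N) (s : ℂ) :
    mellin (charSumError χ) s = ∫ x in Set.Ioi (1 : ℝ), (x : ℂ) ^ (s - 1) *
      (∑ k ∈ Icc 1 ⌊x⌋₊, χ k - (∑ k ∈ Icc 1 N, χ k) / N * x) := by
  have : ∀ x : ℝ, (x : ℂ) ^ (s - 1) • charSumError χ x = (Set.Ioi 1).indicator (fun x : ℝ =>
      (x : ℂ) ^ (s - 1) * (∑ k ∈ Icc 1 ⌊x⌋₊, χ k - (∑ k ∈ Icc 1 N, χ k) / N * x)) x := fun x => by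
    by_cases hx : x ∈ Set.Ioi 1 <;> simp [charSumError, Set.indicator, hx]
  simp_rw [mellin, this]
  rw [MeasureTheory.setIntegral_indicator measurableSet_Ioi, Set.Ioi_inter_Ioi]
  simp

theorem norm_mellin_charSumError_le {N : ℕ} [NeZero N]
    (χ : DirichletCharacter ℂ N) {s : ℂ} (hs : s.re < 0) :
    ‖mellin (charSumError χ) s‖ ≤ 3 * N / (-s.re) := by
  have h : ∀ x ∈ Set.Ioi (1 : ℝ), ‖(x : ℂ) ^ (s - 1) *
      (∑ k ∈ Icc 1 ⌊x⌋₊, χ k - (∑ k ∈ Icc 1 N, χ k) / N * x)‖ ≤ x ^ (s.re - 1) * (3 * N) := by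
    intro x hx
    have := norm_charSumError_le χ x
    rw [charSumError, Set.indicator_of_mem hx] at this
    rw [norm_mul, Complex.norm_cpow_eq_rpow_re_of_pos (zero_lt_one.trans hx)]
    simp only [Complex.sub_re, Complex.one_re]
    gcongr
    exact Real.rpow_nonneg (zero_lt_one.trans hx).le _
  rw [mellin_charSumError]
  refine (MeasureTheory.norm_integral_le_of_norm_le
    ((integrableOn_Ioi_rpow_of_lt (by linarith) zero_lt_one).mul_const _)
    ((MeasureTheory.ae_restrict_iff' measurableSet_Ioi).2 (Eventually.of_forall h))).trans_eq ?_
  rw [MeasureTheory.integral_mul_const, integral_Ioi_rpow_of_lt (by linarith) zero_lt_one]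
  simp
  have := hs.ne
  field_simp

theorem LSeries_eq_mellin_charSumError {N : ℕ} [NeZero N]
    (χ : DirichletCharacter ℂ N) {s : ℂ} (hs : 1 < s.re) :
    LSeries (χ ·) s = s * mellin (charSumError χ) (-s) +
      (∑ k ∈ Icc 1 N, χ k) / N * s / (s - 1) := by
  have hs1 : s - 1 ≠ 0 := fun h => by
    have := congrArg Complex.re h
    simp at this; linarith
  rw [LSeries_eq_mul_integral (fun n => χ n) zero_le_one hs (χ.LSeriesSummable_of_one_lt_re hs)
    (Asymptotics.IsBigO.of_bound 1 (Eventually.of_forall fun n => by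
      simpa using norm_sum_le_of_le (Icc 1 n) (f := fun k : ℕ => χ k) (n := fun _ => (1 : ℝ))
        fun k _ => χ.norm_le_one _)),
    mul_div_right_comm, mul_comm _ s, ← mul_add]
  congr 1
  set c : ℂ := (∑ k ∈ Icc 1 N, χ k) / N
  have hint : MeasureTheory.IntegrableOn (fun x : ℝ => (x : ℂ) ^ (-s - 1) *
      (∑ k ∈ Icc 1 ⌊x⌋₊, χ k - c * x)) (Set.Ioi 1) := by
    have h := (mellinConvergent_of_isBigO_rpow (locallyIntegrableOn_charSumError χ)
      (charSumError_isBigO_atTop χ) (s := -s) (by simp; linarith)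
      (charSumError_isBigO_zero χ ((-s).re - 1)) (by linarith)).mono_set
      (Set.Ioi_subset_Ioi zero_le_one)
    refine h.congr_fun (fun x hx => ?_) measurableSet_Ioi
    simp [charSumError, Set.indicator_of_mem hx, c]
  have hint' : MeasureTheory.IntegrableOn (fun x : ℝ => c * (x : ℂ) ^ (-s)) (Set.Ioi 1) :=
    (integrableOn_Ioi_cpow_of_lt (by simpa using hs) zero_lt_one).const_mul _
  have hval : ∫ x in Set.Ioi (1 : ℝ), c * (x : ℂ) ^ (-s) = c / (s - 1) := by
    rw [MeasureTheory.integral_const_mul, integral_Ioi_cpow_of_lt (by simpa using hs) zero_lt_one]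
    simp only [Complex.ofReal_one, Complex.one_cpow]
    rw [show -s + 1 = -(s - 1) by ring, neg_div_neg_eq, mul_one_div]
  rw [mellin_charSumError, ← hval, ← MeasureTheory.integral_add hint hint']
  refine MeasureTheory.setIntegral_congr_fun measurableSet_Ioi fun x hx => ?_
  have hx0 : (x : ℂ) ≠ 0 := by exact_mod_cast (zero_lt_one.trans hx).ne'
  have hx1 : (x : ℂ) ^ (-s) = (x : ℂ) ^ (-s - 1) * x := by
    rw [Complex.cpow_sub _ _ hx0, Complex.cpow_one, div_mul_cancel₀ _ hx0]
  simp only [neg_add', hx1]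
  ring

theorem eqOn_re_pos_of_eqOn_one_lt_re {f g : ℂ → ℂ}
    (hf : DifferentiableOn ℂ f {s | 0 < s.re}) (hg : DifferentiableOn ℂ g {s | 0 < s.re})
    (h : ∀ s : ℂ, 1 < s.re → f s = g s) {s : ℂ} (hs : 0 < s.re) : f s = g s := by
  have hopen : IsOpen {s : ℂ | 0 < s.re} := isOpen_lt continuous_const Complex.continuous_re
  have hopen' : IsOpen {s : ℂ | 1 < s.re} := isOpen_lt continuous_const Complex.continuous_re
  refine (hf.analyticOnNhd hopen).eqOn_of_preconnected_of_eventuallyEq (hg.analyticOnNhd hopen)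
    (convex_halfSpace_re_gt 0).isPreconnected (z₀ := 2) (by simp) ?_ hs
  filter_upwards [hopen'.mem_nhds (show (2 : ℂ) ∈ {s : ℂ | 1 < s.re} by simp)] with z hz
  exact h z hz

theorem differentiableOn_mellin_charSumError_neg {N : ℕ} [NeZero N]
    (χ : DirichletCharacter ℂ N) :
    DifferentiableOn ℂ (fun s => mellin (charSumError χ) (-s)) {s | 0 < s.re} := fun s hs =>
  ((differentiableAt_mellin_charSumError χ (s := -s) (by simpa using hs)).comp s
    differentiableAt_id.neg).differentiableWithinAt

theorem LFunction_eq_mul_mellin_charSumError {N : ℕ} [NeZero N] {χ : DirichletCharacter ℂ N}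
    (hχ : χ ≠ 1) {s : ℂ} (hs : 0 < s.re) :
    DirichletCharacter.LFunction χ s = s * mellin (charSumError χ) (-s) := by
  have hL := DirichletCharacter.differentiable_LFunction hχ
  have hH := differentiableOn_mellin_charSumError_neg χ
  have hmean : (∑ k ∈ Icc 1 N, χ k) / N = 0 := by
    have := eqOn_re_pos_of_eqOn_one_lt_re
      (f := fun s => (s - 1) * DirichletCharacter.LFunction χ s)
      (g := fun s => (s - 1) * (s * mellin (charSumError χ) (-s)) +
        (∑ k ∈ Icc 1 N, χ k) / N * s)
      (by fun_prop) (by fun_prop) (fun s hs => by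
        have hs1 : s - 1 ≠ 0 := fun h => by
          have := congrArg Complex.re h
          simp at this; linarith
        simp only [DirichletCharacter.LFunction_eq_LSeries χ hs,
          LSeries_eq_mellin_charSumError χ hs]
        field_simp) (s := 1) (by simp)
    simpa using this.symm
  refine eqOn_re_pos_of_eqOn_one_lt_re (f := DirichletCharacter.LFunction χ)
    (g := fun s => s * mellin (charSumError χ) (-s)) (by fun_prop) (by fun_prop)
    (fun s hs => ?_) hs
  rw [DirichletCharacter.LFunction_eq_LSeries χ hs, LSeries_eq_mellin_charSumError χ hs, hmean]
  simp

theorem LFunctionTrivChar₁_eq_mellin_charSumError {N : ℕ} [NeZero N] {s : ℂ} (hs : 0 < s.re) :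
    DirichletCharacter.LFunctionTrivChar₁ N s =
      s * ((s - 1) * mellin (charSumError (1 : DirichletCharacter ℂ N)) (-s) +
        (∑ k ∈ Icc 1 N, (1 : DirichletCharacter ℂ N) k) / N) := by
  have hL := DirichletCharacter.differentiable_LFunctionTrivChar₁ N
  have hH := differentiableOn_mellin_charSumError_neg (1 : DirichletCharacter ℂ N)
  refine eqOn_re_pos_of_eqOn_one_lt_re (f := DirichletCharacter.LFunctionTrivChar₁ N)
    (g := fun s => s * ((s - 1) * mellin (charSumError (1 : DirichletCharacter ℂ N)) (-s) +
        (∑ k ∈ Icc 1 N, (1 : DirichletCharacter ℂ N) k) / N)) hL.differentiableOn (by fun_prop)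
    (fun s hs => ?_) hs
  have hs1 : s ≠ 1 := fun h => by
    have := congrArg Complex.re h
    simp at this; linarith
  have hs1' := sub_ne_zero.2 hs1
  rw [DirichletCharacter.LFunctionTrivChar₁, Function.update_of_ne hs1,
    DirichletCharacter.LFunctionTrivChar, DirichletCharacter.LFunction_eq_LSeries _ hs,
    LSeries_eq_mellin_charSumError _ hs]
  field_simp

theorem norm_sub_one_le_of_half_le_re {s : ℂ} (hs : 1 / 2 ≤ s.re) : ‖s - 1‖ ≤ ‖s‖ := by
  refine (sq_le_sq₀ (norm_nonneg _) (norm_nonneg _)).1 ?_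
  rw [Complex.sq_norm, Complex.sq_norm, Complex.normSq_apply, Complex.normSq_apply]
  simp only [Complex.sub_re, Complex.sub_im, Complex.one_re, Complex.one_im]
  nlinarith

/-- Under GRH, `L(s, χ)` times a harmless factor `u` removing a possible pole at `s = 1` is
holomorphic, zero-free and of moderate growth on `Re s > 1/2`. -/
theorem exists_regularized_LFunction {N : ℕ} [NeZero N] (χ : DirichletCharacter ℂ N)
    (GRH : ∀ s : ℂ, DirichletCharacter.LFunction χ s = 0 → 0 < s.re → s.re < 1 → s.re = 1 / 2) :
    ∃ f u : ℂ → ℂ, DifferentiableOn ℂ f {s | 1 / 2 < s.re} ∧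
      DifferentiableOn ℂ u {s | 1 / 2 < s.re} ∧
      (∀ s : ℂ, 1 / 2 < s.re → f s ≠ 0 ∧ ‖f s‖ ≤ 8 * N * ‖s‖ ∧ ‖u s‖ ≤ 1) ∧
      (∀ s : ℂ, 1 < s.re → f s = u s * LSeries (χ ·) s ∧ u s ≠ 0) ∧
      (∀ s : ℂ, 3 / 2 ≤ s.re → ‖(u s)⁻¹‖ ≤ 3) := by
  have hN : (1 : ℝ) ≤ N := by exact_mod_cast NeZero.pos N
  have hne : ∀ s : ℂ, 1 / 2 < s.re → χ ≠ 1 ∨ s ≠ 1 → DirichletCharacter.LFunction χ s ≠ 0 := by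
    intro s hs h h0
    rcases lt_or_ge s.re 1 with h1 | h1
    · have := GRH s h0 (by linarith) h1
      linarith
    · exact DirichletCharacter.LFunction_ne_zero_of_one_le_re χ h h1 h0
  have hmel : ∀ s : ℂ, 1 / 2 < s.re → ‖mellin (charSumError χ) (-s)‖ ≤ 6 * N := by
    intro s hs
    refine (norm_mellin_charSumError_le χ (s := -s) (by simp; linarith)).trans ?_
    rw [Complex.neg_re, neg_neg, div_le_iff₀ (by linarith)]
    nlinarith
  have hnorm : ∀ s : ℂ, 1 / 2 < s.re → 1 / 2 ≤ ‖s‖ := fun s hs =>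
    hs.le.trans ((le_abs_self _).trans (Complex.abs_re_le_norm s))
  by_cases hχ : χ = 1
  · subst hχ
    have hs0 : ∀ s : ℂ, 1 / 2 < s.re → s ≠ 0 := fun s hs h => by
      have := hnorm s hs
      rw [h, norm_zero] at this; norm_num at this
    refine ⟨fun s => DirichletCharacter.LFunctionTrivChar₁ N s / s, fun s => (s - 1) / s,
      ?_, ?_, fun s hs => ⟨?_, ?_, ?_⟩, fun s hs => ⟨?_, ?_⟩, fun s hs => ?_⟩
    · exact (DirichletCharacter.differentiable_LFunctionTrivChar₁ N).differentiableOn.div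
        differentiableOn_id fun s hs => hs0 s hs
    · exact (differentiableOn_id.sub_const 1).div differentiableOn_id fun s hs => hs0 s hs
    · refine div_ne_zero ?_ (hs0 s hs)
      by_cases h1 : s = 1
      · subst h1
        exact DirichletCharacter.LFunctionTrivChar₁_apply_one_ne_zero N
      · rw [DirichletCharacter.LFunctionTrivChar₁, Function.update_of_ne h1]
        exact mul_ne_zero (sub_ne_zero.2 h1) (hne s hs (.inr h1))
    · simp only
      rw [LFunctionTrivChar₁_eq_mellin_charSumError (by linarith),
        mul_div_cancel_left₀ _ (hs0 s hs)]
      have h1 := norm_mean_dirichletCharacter_le_one (1 : DirichletCharacter ℂ N)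
      have h2 := norm_sub_one_le_of_half_le_re hs.le
      have h3 := hnorm s hs
      calc _ ≤ ‖s - 1‖ * ‖mellin (charSumError (1 : DirichletCharacter ℂ N)) (-s)‖ + 1 := by
            rw [← norm_mul]
            exact (norm_add_le _ _).trans (by gcongr)
        _ ≤ ‖s‖ * (6 * N) + 1 := by gcongr; exact hmel s hs
        _ ≤ _ := by nlinarith
    · rw [norm_div]
      exact div_le_one_of_le₀ (norm_sub_one_le_of_half_le_re hs.le) (norm_nonneg _)
    · have h1 : s ≠ 1 := fun h => by simp [h] at hs
      simp only
      rw [DirichletCharacter.LFunctionTrivChar₁, Function.update_of_ne h1,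
        DirichletCharacter.LFunctionTrivChar, DirichletCharacter.LFunction_eq_LSeries _ hs]
      ring
    · have h1 : s ≠ 1 := fun h => by simp [h] at hs
      exact div_ne_zero (sub_ne_zero.2 h1) (hs0 s (by linarith))
    · have h1 : 1 / 2 ≤ ‖s - 1‖ := by
        refine le_trans ?_ ((le_abs_self _).trans (Complex.abs_re_le_norm (s - 1)))
        simp; linarith
      rw [inv_div, norm_div, div_le_iff₀ (by linarith)]
      calc ‖s‖ = ‖(s - 1) + 1‖ := by ring_nf
        _ ≤ ‖s - 1‖ + 1 := (norm_add_le _ _).trans (by simp)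
        _ ≤ _ := by linarith
  · refine ⟨DirichletCharacter.LFunction χ, fun _ => 1,
      (DirichletCharacter.differentiable_LFunction hχ).differentiableOn, by fun_prop,
      fun s hs => ⟨hne s hs (.inl hχ), ?_, by simp⟩,
      fun s hs => ⟨by rw [one_mul, DirichletCharacter.LFunction_eq_LSeries χ hs], one_ne_zero⟩,
      fun s hs => by simp⟩
    rw [LFunction_eq_mul_mellin_charSumError hχ (by linarith), norm_mul]
    have := hmel s hs
    nlinarith [norm_nonneg s]

theorem norm_LSeries_le_tsum_rpow {a : ℕ → ℂ} (ha : ∀ n, ‖a n‖ ≤ 1) {σ : ℝ} (hσ : 1 < σ) {s : ℂ}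
    (hs : σ ≤ s.re) : ‖LSeries a s‖ ≤ ∑' n : ℕ, (n : ℝ) ^ (-σ) := by
  refine tsum_of_norm_bounded (Real.summable_nat_rpow.2 (by linarith)).hasSum fun n => ?_
  rcases eq_or_ne n 0 with rfl | hn
  · simp; positivity
  · rw [LSeries.norm_term_eq, if_neg hn, Real.rpow_neg (by positivity), ← one_div]
    have : (1 : ℝ) ≤ n := by exact_mod_cast Nat.one_le_iff_ne_zero.2 hn
    gcongr
    exact ha n

/-- Under GRH, the Dirichlet series of `μ χ` continues to `Re s > 1/2` with subpolynomial growth,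
uniformly in the modulus. -/
theorem exists_continuation_LSeries_moebius
    (GRH : ∀ (N : ℕ) [NeZero N] (χ : DirichletCharacter ℂ N) (s : ℂ),
      DirichletCharacter.LFunction χ s = 0 → 0 < s.re → s.re < 1 → s.re = 1 / 2)
    {δ η : ℝ} (hδ : 0 < δ) (hδ' : δ ≤ 3 / 2) (hη : 0 < η) :
    ∃ C : ℝ, 0 < C ∧ ∀ (N : ℕ) [NeZero N] (χ : DirichletCharacter ℂ N),
      ∃ F : ℂ → ℂ, DifferentiableOn ℂ F {s | 1 / 2 < s.re} ∧
        (∀ s : ℂ, 1 < s.re →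
          F s = LSeries (fun n => χ n * (ArithmeticFunction.moebius n : ℂ)) s) ∧
        ∀ s : ℂ, 1 / 2 + δ ≤ s.re → s.re ≤ 2 → ‖F s‖ ≤ C * (N * (|s.im| + 4)) ^ η := by
  set Z : ℝ := ∑' n : ℕ, (n : ℝ) ^ (-(3 / 2 : ℝ)) with hZ
  have hZ0 : 0 ≤ Z := tsum_nonneg fun n => by positivity
  obtain ⟨C, hC, hmain⟩ := exists_norm_inv_le_rpow (R := 3 / 2) (r := 3 / 2 - δ) (r₀ := 1 / 2)
    (K := 3 * Z + 1) (by norm_num) (by norm_num) (by linarith) (by linarith) (by linarith) hη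
  refine ⟨C * 8 ^ η, by positivity, fun N _ χ => ?_⟩
  have hN : (1 : ℝ) ≤ N := by exact_mod_cast NeZero.pos N
  obtain ⟨f, u, hf, hu, hfu, hL, hu3⟩ := exists_regularized_LFunction χ (GRH N χ)
  have hLZ : ∀ s : ℂ, 3 / 2 ≤ s.re → ‖LSeries (χ ·) s‖ ≤ Z := fun s hs =>
    norm_LSeries_le_tsum_rpow (fun n => χ.norm_le_one _) (by norm_num) hs
  have hinv : ∀ s : ℂ, 1 < s.re →
      (LSeries (χ ·) s)⁻¹ = LSeries (fun n => χ n * (ArithmeticFunction.moebius n : ℂ)) s :=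
    fun s hs => inv_eq_of_mul_eq_one_right (DirichletCharacter.LSeries.mul_mu_eq_one χ hs)
  have hmuZ : ∀ s : ℂ, 3 / 2 ≤ s.re → ‖(LSeries (χ ·) s)⁻¹‖ ≤ Z := fun s hs => by
    rw [hinv s (by linarith)]
    refine norm_LSeries_le_tsum_rpow (fun n => ?_) (by norm_num) hs
    rw [norm_mul]
    refine mul_le_one₀ (χ.norm_le_one _) (norm_nonneg _) ?_
    rw [Complex.norm_intCast]
    exact_mod_cast ArithmeticFunction.abs_moebius_le_one
  refine ⟨fun s => u s * (f s)⁻¹, hu.mul (hf.inv fun s hs => (hfu s hs).1), fun s hs => ?_,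
    fun s hs hs2 => ?_⟩
  · simp only
    rw [(hL s hs).1, mul_inv, mul_inv_cancel_left₀ (hL s hs).2, hinv s hs]
  · have hball : ∀ ρ : ℝ, ∀ z ∈ Metric.ball (2 + s.im * Complex.I : ℂ) ρ,
        2 - ρ < z.re ∧ ‖z‖ ≤ 2 + |s.im| + ρ := by
      intro ρ z hz
      rw [Metric.mem_ball, dist_eq_norm] at hz
      constructor
      · have := (abs_lt.1 ((Complex.abs_re_le_norm _).trans_lt hz)).1
        simp at this
        linarith
      · calc ‖z‖ = ‖(z - (2 + s.im * Complex.I)) + (2 + s.im * Complex.I)‖ := by ring_nf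
          _ ≤ ρ + (2 + |s.im|) := by
            refine (norm_add_le _ _).trans (add_le_add hz.le ((norm_add_le _ _).trans ?_))
            simp
          _ = _ := by ring
    have hfball : ∀ z ∈ Metric.ball (2 + s.im * Complex.I : ℂ) (3 / 2), 1 / 2 < z.re := by
      intro z hz
      linarith [(hball _ z hz).1]
    have hre : (2 + s.im * Complex.I : ℂ).re = 2 := by simp
    have h := hmain f (2 + s.im * Complex.I) (8 * (N * (|s.im| + 4)))
      (by nlinarith [abs_nonneg s.im])
      (hf.mono hfball) (fun z hz => (hfu z (hfball z hz)).1)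
      (fun z hz => by
        refine (hfu z (hfball z hz)).2.1.trans ?_
        rw [mul_assoc]
        gcongr
        linarith [(hball _ z hz).2])
      (fun z hz => by
        have hz' := (hball _ z hz).1
        rw [(hL z (by linarith)).1, norm_mul]
        have h1 := (hfu z (by linarith)).2.2
        have h2 := hLZ z (by linarith)
        nlinarith [norm_nonneg (LSeries (χ ·) z), norm_nonneg (u z)])
      (by
        rw [(hL _ (by rw [hre]; norm_num)).1, mul_inv, norm_mul]
        have h1 := hu3 (2 + s.im * Complex.I) (by rw [hre]; norm_num)
        have h2 := hmuZ (2 + s.im * Complex.I) (by rw [hre]; norm_num)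
        have := mul_le_mul h1 h2 (norm_nonneg _) (by norm_num)
        linarith)
      s (by
        have : s - (2 + s.im * Complex.I) = ((s.re - 2 : ℝ) : ℂ) := by
          apply Complex.ext <;> simp
        rw [this, Complex.norm_real, Real.norm_eq_abs, abs_le]
        constructor <;> linarith)
    rw [Real.mul_rpow (by norm_num) (by positivity), ← mul_assoc] at h
    rw [norm_mul]
    exact (mul_le_of_le_one_left (norm_nonneg _) (hfu s (by linarith)).2.2).trans h

theorem norm_inv_mul_add_one_le {s : ℂ} (hs : 1 / 2 ≤ s.re) :
    ‖(s * (s + 1))⁻¹‖ ≤ 9 * (1 + |s.im|) ^ (-2 : ℝ) := by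
  have h1 : (1 + |s.im|) / 3 ≤ ‖s‖ := by
    have := Complex.abs_im_le_norm s
    have := (le_abs_self _).trans (Complex.abs_re_le_norm s)
    linarith
  have h2 : (1 + |s.im|) / 3 ≤ ‖s + 1‖ := by
    have h3 := Complex.abs_im_le_norm (s + 1)
    have h4 := (le_abs_self _).trans (Complex.abs_re_le_norm (s + 1))
    simp at h3 h4
    linarith
  have h0 : 0 < 1 + |s.im| := by positivity
  rw [norm_inv, norm_mul, Real.rpow_neg h0.le, Real.rpow_two]
  calc (‖s‖ * ‖s + 1‖)⁻¹ ≤ ((1 + |s.im|) / 3 * ((1 + |s.im|) / 3))⁻¹ := by gcongr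
    _ = _ := by field_simp; norm_num

theorem ne_zero_of_half_le_re {s : ℂ} (hs : 1 / 2 ≤ s.re) : s * (s + 1) ≠ 0 := by
  refine mul_ne_zero (fun h => ?_) (fun h => ?_)
  · simp [h] at hs; linarith
  · have := congrArg Complex.re h
    simp at this; linarith

theorem integrable_one_add_abs_rpow {r : ℝ} (hr : 1 < r) :
    MeasureTheory.Integrable (fun y : ℝ => (1 + |y|) ^ (-r)) := by
  simpa using integrable_one_add_norm (E := ℝ) (μ := MeasureTheory.volume) (r := r) (by simpa)

theorem integrable_inv_mul_add_one {σ : ℝ} (hσ : 1 / 2 ≤ σ) : MeasureTheory.Integrable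
    (fun y : ℝ => (((σ : ℂ) + y * Complex.I) * ((σ : ℂ) + y * Complex.I + 1))⁻¹) := by
  refine ((integrable_one_add_abs_rpow one_lt_two).const_mul 9).mono' ?_
    (Eventually.of_forall fun y => ?_)
  · refine (Continuous.inv₀ (by fun_prop) fun y => ?_).aestronglyMeasurable
    exact ne_zero_of_half_le_re (by simpa using hσ)
  · simpa using norm_inv_mul_add_one_le (s := (σ : ℂ) + y * Complex.I) (by simpa using hσ)

/-- The kernel `(1 - u)₊` as an inverse Mellin transform. -/
theorem integral_cpow_mul_inv_mul_add_one {u : ℝ} (hu : 0 < u) :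
    ∫ y : ℝ, (u : ℂ) ^ (-(((2 : ℝ) : ℂ) + y * Complex.I)) *
      ((((2 : ℝ) : ℂ) + y * Complex.I) * (((2 : ℝ) : ℂ) + y * Complex.I + 1))⁻¹ =
    2 * Real.pi * (max (1 - u) 0 : ℝ) := by
  set f : ℝ → ℂ := fun u => (Set.Ioc 0 1).indicator (fun _ => 1 : ℝ → ℂ) u -
    (Set.Ioc 0 1).indicator (fun t => ↑t ^ (1 : ℂ) : ℝ → ℂ) u with hf
  have hmel : ∀ s : ℂ, 0 < s.re → HasMellin f s ((s * (s + 1))⁻¹) := by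
    intro s hs
    have h := (hasMellin_one_Ioc hs)
    have h' := (hasMellin_cpow_Ioc 1 (s := s) (by simp; linarith))
    have h0 : s ≠ 0 := fun h => by simp [h] at hs
    have h1 : s + 1 ≠ 0 := fun h => by
      have := congrArg Complex.re h
      simp at this; linarith
    have := hasMellin_sub h.1 h'.1
    have heq : 1 / s - 1 / (s + 1) = (s * (s + 1))⁻¹ := by
      field_simp
      ring
    rw [h.2, h'.2, heq] at this
    exact this
  have hfu : ∀ v : ℝ, 0 < v → f v = (max (1 - v) 0 : ℝ) := by
    intro v hv
    by_cases h1 : v ≤ 1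
    · rw [max_eq_left (by linarith)]
      simp [hf, Set.indicator, hv, h1]
    · rw [max_eq_right (by linarith)]
      simp [hf, Set.indicator, h1]
  have hm : ∀ y : ℝ, mellin f (((2 : ℝ) : ℂ) + y * Complex.I) =
      ((((2 : ℝ) : ℂ) + y * Complex.I) * (((2 : ℝ) : ℂ) + y * Complex.I + 1))⁻¹ := fun y =>
    (hmel _ (by simp)).2
  have h := mellinInv_mellin_eq 2 f hu (hmel _ (by simp)).1
    (by
      unfold Complex.VerticalIntegrable
      simp_rw [hm]
      exact integrable_inv_mul_add_one (by norm_num))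
    (by
      have : (fun v : ℝ => ((max (1 - v) 0 : ℝ) : ℂ)) =ᶠ[nhds u] f := by
        filter_upwards [Ioi_mem_nhds hu] with v hv
        exact (hfu v hv).symm
      refine ContinuousAt.congr (Continuous.continuousAt ?_) this
      fun_prop)
  rw [hfu u hu, mellinInv] at h
  simp_rw [hm] at h
  rw [← h]
  have hpi : (2 * Real.pi : ℂ) ≠ 0 := by simp [Real.pi_ne_zero]
  rw [Complex.real_smul, Complex.ofReal_div, Complex.ofReal_one, Complex.ofReal_mul,
    Complex.ofReal_ofNat, ← mul_assoc, mul_one_div_cancel hpi, one_mul]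
  rfl

/-- Perron's formula for the first Cesàro mean. -/
theorem integral_LSeries_mul_eq_sum {a : ℕ → ℂ} (ha : ∀ n, ‖a n‖ ≤ 1) {x : ℝ} (hx : 0 < x) :
    ∫ y : ℝ, LSeries a (((2 : ℝ) : ℂ) + y * Complex.I) *
      ((x : ℂ) ^ (((2 : ℝ) : ℂ) + y * Complex.I) *
        ((((2 : ℝ) : ℂ) + y * Complex.I) * (((2 : ℝ) : ℂ) + y * Complex.I + 1))⁻¹) =
    2 * Real.pi * ∑ n ∈ Icc 1 ⌊x⌋₊, a n * (1 - n / x) := by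
  set S : ℝ → ℂ := fun y => ((2 : ℝ) : ℂ) + y * Complex.I with hS
  have hSre : ∀ y, (S y).re = 2 := fun y => by simp [hS]
  have hSim : ∀ y, (S y).im = y := fun y => by simp [hS]
  have hScont : Continuous S := by fun_prop
  have hx0 : (x : ℂ) ≠ 0 := by exact_mod_cast hx.ne'
  set g : ℕ → ℝ → ℂ := fun n y =>
    LSeries.term a (S y) n * ((x : ℂ) ^ (S y) * (S y * (S y + 1))⁻¹) with hg
  have hbound : ∀ n y, ‖g n y‖ ≤
      (n : ℝ) ^ (-2 : ℝ) * (x ^ (2 : ℝ) * (9 * (1 + |y|) ^ (-2 : ℝ))) := by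
    intro n y
    rw [hg]
    simp only [norm_mul]
    have h1 : ‖LSeries.term a (S y) n‖ ≤ (n : ℝ) ^ (-2 : ℝ) := by
      rcases eq_or_ne n 0 with rfl | hn
      · simp
      · rw [LSeries.norm_term_eq, if_neg hn, Real.rpow_neg (by positivity), ← one_div, hSre]
        gcongr
        exact ha n
    have h2 := norm_inv_mul_add_one_le (s := S y) (by rw [hSre]; norm_num)
    rw [hSim, norm_inv, norm_mul] at h2
    rw [Complex.norm_cpow_eq_rpow_re_of_pos hx, hSre, norm_inv, norm_mul]
    gcongr
  have hcont : ∀ n, Continuous (g n) := by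
    intro n
    have h1 : Continuous fun y => (x : ℂ) ^ (S y) := hScont.const_cpow (.inl hx0)
    have h2 : Continuous fun y => (S y * (S y + 1))⁻¹ := Continuous.inv₀ (by fun_prop) fun y =>
      ne_zero_of_half_le_re (by rw [hSre]; norm_num)
    refine Continuous.mul ?_ (h1.mul h2)
    rcases eq_or_ne n 0 with rfl | hn
    · simpa using continuous_const
    · simp only [LSeries.term_of_ne_zero hn]
      have hn' : (n : ℂ) ≠ 0 := by exact_mod_cast hn
      exact continuous_const.div (hScont.const_cpow (.inl hn')) fun y => by
        simp [Complex.cpow_eq_zero_iff, hn']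
  have hdom := ((integrable_one_add_abs_rpow one_lt_two).const_mul 9).const_mul (x ^ (2 : ℝ))
  have hint : ∀ n, MeasureTheory.Integrable (g n) := fun n =>
    (hdom.const_mul _).mono' (hcont n).aestronglyMeasurable (Eventually.of_forall (hbound n))
  have hsum : Summable fun n => ∫ y, ‖g n y‖ := by
    refine Summable.of_nonneg_of_le (fun n => MeasureTheory.integral_nonneg fun y => norm_nonneg _)
      (fun n => ?_) ((Real.summable_nat_rpow.2 (by norm_num : (-2 : ℝ) < -1)).mul_right
        (∫ y, x ^ (2 : ℝ) * (9 * (1 + |y|) ^ (-2 : ℝ))))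
    rw [← MeasureTheory.integral_const_mul]
    exact MeasureTheory.integral_mono (hint n).norm (hdom.const_mul _) (hbound n)
  have hterm : ∀ n, ∫ y, g n y =
      2 * Real.pi * (if n = 0 then 0 else a n * (max (1 - n / x) 0 : ℝ)) := by
    intro n
    rcases eq_or_ne n 0 with rfl | hn
    · simp [hg]
    · have hn0 : (0 : ℝ) < n := by exact_mod_cast Nat.pos_of_ne_zero hn
      rw [if_neg hn, mul_left_comm, ← integral_cpow_mul_inv_mul_add_one (div_pos hn0 hx),
        ← MeasureTheory.integral_const_mul]
      congr 1
      ext y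
      simp only [hg, LSeries.term_of_ne_zero hn]
      rw [Complex.cpow_neg, Complex.ofReal_div, Complex.div_cpow_ofReal_nonneg hn0.le hx.le,
        inv_div, Complex.ofReal_natCast]
      ring
  have h := MeasureTheory.hasSum_integral_of_summable_integral_norm hint hsum
  have h' : ∫ y, ∑' n, g n y = ∫ y, LSeries a (S y) * ((x : ℂ) ^ (S y) * (S y * (S y + 1))⁻¹) := by
    congr 1
    ext y
    simp only [hg]
    rw [tsum_mul_right, LSeries]
  rw [← h', ← h.tsum_eq]
  simp_rw [hterm]
  rw [tsum_mul_left, tsum_eq_sum (s := Icc 1 ⌊x⌋₊)]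
  · congr 1
    refine sum_congr rfl fun n hn => ?_
    obtain ⟨h1, h2⟩ := mem_Icc.1 hn
    rw [if_neg (by omega), max_eq_left]
    · push_cast; rfl
    · rw [sub_nonneg, div_le_one hx]
      exact (Nat.le_floor_iff hx.le).1 h2
  · intro n hn
    split_ifs with h0
    · rfl
    · rw [max_eq_right]
      · simp
      · rw [sub_nonpos, one_le_div hx]
        by_contra! hlt
        exact hn (mem_Icc.2 ⟨Nat.one_le_iff_ne_zero.2 h0, Nat.le_floor hlt.le⟩)

/-- Shifting a vertical line of integration. -/
theorem integral_vertical_line_eq {G : ℂ → ℂ} {σ₁ σ₂ B r : ℝ} (hσ : σ₁ ≤ σ₂) (hr : 1 < r)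
    (hG : DifferentiableOn ℂ G {s | σ₁ ≤ s.re ∧ s.re ≤ σ₂})
    (hB : ∀ s : ℂ, σ₁ ≤ s.re → s.re ≤ σ₂ → ‖G s‖ ≤ B * (1 + |s.im|) ^ (-r)) :
    ∫ y : ℝ, G (σ₁ + y * Complex.I) = ∫ y : ℝ, G (σ₂ + y * Complex.I) := by
  have hint : ∀ σ : ℝ, σ₁ ≤ σ → σ ≤ σ₂ →
      MeasureTheory.Integrable fun y : ℝ => G (σ + y * Complex.I) := by
    intro σ h1 h2
    refine ((integrable_one_add_abs_rpow hr).const_mul B).mono' ?_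
      (Eventually.of_forall fun y => ?_)
    · refine Continuous.aestronglyMeasurable ?_
      exact hG.continuousOn.comp_continuous (by fun_prop) fun y => by simp [h1, h2]
    · simpa using hB (σ + y * Complex.I) (by simpa) (by simpa)
  have hlim : ∀ σ : ℝ, σ₁ ≤ σ → σ ≤ σ₂ → Tendsto
      (fun T : ℝ => ∫ y in (-T)..T, G (σ + y * Complex.I)) atTop
      (nhds (∫ y : ℝ, G (σ + y * Complex.I))) := fun σ h1 h2 =>
    MeasureTheory.intervalIntegral_tendsto_integral (hint σ h1 h2) tendsto_neg_atTop_atBot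
      tendsto_id
  have hhor : ∀ e : ℝ → ℝ, (∀ T, |e T| = |T|) → Tendsto
      (fun T : ℝ => ∫ x in σ₁..σ₂, G (x + e T * Complex.I)) atTop (nhds 0) := by
    intro e he
    have hdecay : Tendsto (fun T : ℝ => B * (1 + |T|) ^ (-r) * |σ₂ - σ₁|) atTop (nhds 0) := by
      have h1 : Tendsto (fun T : ℝ => 1 + |T|) atTop atTop :=
        tendsto_atTop_add_const_left _ _ tendsto_abs_atTop_atTop
      have h2 := (tendsto_rpow_neg_atTop (by linarith : 0 < r)).comp h1
      simpa using (h2.const_mul B).mul_const |σ₂ - σ₁|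
    refine squeeze_zero_norm (fun T => ?_) hdecay
    refine intervalIntegral.norm_integral_le_of_norm_le_const fun x hx => ?_
    rw [Set.uIoc_of_le hσ] at hx
    have := hB (x + e T * Complex.I) (by simpa using hx.1.le) (by simpa using hx.2)
    simpa [he] using this
  have hrect : ∀ T : ℝ, (∫ x in σ₁..σ₂, G (x + (-T : ℝ) * Complex.I)) -
      (∫ x in σ₁..σ₂, G (x + (T : ℝ) * Complex.I)) +
      Complex.I * (∫ y in (-T)..T, G (σ₂ + y * Complex.I)) -
      Complex.I * (∫ y in (-T)..T, G (σ₁ + y * Complex.I)) = 0 := by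
    intro T
    have := Complex.integral_boundary_rect_eq_zero_of_differentiableOn G
      (⟨σ₁, -T⟩ : ℂ) ⟨σ₂, T⟩ (hG.mono fun s hs => by
        have := hs.1
        rw [Set.mem_preimage, Set.uIcc_of_le hσ] at this
        exact this)
    simpa using this
  have hfin := (((hhor (fun T => -T) (fun T => abs_neg T)).sub (hhor id fun T => rfl)).add
    ((hlim σ₂ hσ le_rfl).const_mul Complex.I)).sub ((hlim σ₁ le_rfl hσ).const_mul Complex.I)
  have := tendsto_nhds_unique (hfin.congr fun T => hrect T) tendsto_const_nhds
  have hI : Complex.I * ((∫ y : ℝ, G (σ₂ + y * Complex.I)) -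
      ∫ y : ℝ, G (σ₁ + y * Complex.I)) = 0 := by
    rw [← this]; ring
  exact (sub_eq_zero.1 ((mul_eq_zero.1 hI).resolve_left Complex.I_ne_zero)).symm

/-- The first Cesàro mean of `χ μ` is small under GRH. -/
theorem exists_norm_sum_mul_sub_le
    (GRH : ∀ (N : ℕ) [NeZero N] (χ : DirichletCharacter ℂ N) (s : ℂ),
      DirichletCharacter.LFunction χ s = 0 → 0 < s.re → s.re < 1 → s.re = 1 / 2)
    {δ η : ℝ} (hδ : 0 < δ) (hδ' : δ ≤ 3 / 2) (hη : 0 < η) (hη' : η ≤ 1 / 2) :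
    ∃ C : ℝ, 0 < C ∧ ∀ (N : ℕ) [NeZero N] (χ : DirichletCharacter ℂ N) (x : ℝ), 1 ≤ x →
      ‖∑ n ∈ Icc 1 ⌊x⌋₊, χ n * (ArithmeticFunction.moebius n : ℂ) * (x - n)‖ ≤
        C * (N : ℝ) ^ η * x ^ (3 / 2 + δ) := by
  obtain ⟨C, hC, hF⟩ := exists_continuation_LSeries_moebius GRH hδ hδ' hη
  set J : ℝ := ∫ y : ℝ, (1 + |y|) ^ (-(3 / 2) : ℝ) with hJ
  have hJ0 : 0 ≤ J := MeasureTheory.integral_nonneg fun y => by positivity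
  refine ⟨18 * C * (J + 1), by positivity, fun N _ χ x hx => ?_⟩
  obtain ⟨F, hFd, hFL, hFb⟩ := hF N χ
  have hx0 : 0 < x := by linarith
  have hxc : (x : ℂ) ≠ 0 := by exact_mod_cast hx0.ne'
  set G : ℂ → ℂ := fun s => F s * ((x : ℂ) ^ s * (s * (s + 1))⁻¹) with hG
  have hGb : ∀ s : ℂ, 1 / 2 + δ ≤ s.re → s.re ≤ 2 →
      ‖G s‖ ≤ 18 * C * (N : ℝ) ^ η * x ^ s.re * (1 + |s.im|) ^ (-(3 / 2) : ℝ) := by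
    intro s h1 h2
    have hI : 0 < 1 + |s.im| := by positivity
    have hN : (N * (|s.im| + 4)) ^ η ≤ (N : ℝ) ^ η * (2 * (1 + |s.im|) ^ (1 / 2 : ℝ)) := by
      rw [Real.mul_rpow (by positivity) (by positivity)]
      gcongr
      calc (|s.im| + 4) ^ η ≤ (|s.im| + 4) ^ (1 / 2 : ℝ) :=
            Real.rpow_le_rpow_of_exponent_le (by linarith [abs_nonneg s.im]) hη'
        _ ≤ (4 * (1 + |s.im|)) ^ (1 / 2 : ℝ) := by
            gcongr
            linarith [abs_nonneg s.im]
        _ = 2 * (1 + |s.im|) ^ (1 / 2 : ℝ) := by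
            rw [Real.mul_rpow (by norm_num) hI.le, show (4 : ℝ) = 2 ^ (2 : ℝ) by norm_num,
              ← Real.rpow_mul (by norm_num)]
            norm_num
    have hexp : (1 + |s.im|) ^ (-(3 / 2) : ℝ) =
        (1 + |s.im|) ^ (1 / 2 : ℝ) * (1 + |s.im|) ^ (-2 : ℝ) := by
      rw [← Real.rpow_add hI]
      norm_num
    calc ‖G s‖ = ‖F s‖ * (x ^ s.re * ‖(s * (s + 1))⁻¹‖) := by
          rw [hG]
          simp only [norm_mul, Complex.norm_cpow_eq_rpow_re_of_pos hx0]
      _ ≤ C * ((N : ℝ) ^ η * (2 * (1 + |s.im|) ^ (1 / 2 : ℝ))) *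
          (x ^ s.re * (9 * (1 + |s.im|) ^ (-2 : ℝ))) := by
          gcongr
          · exact (hFb s h1 h2).trans (by gcongr)
          · exact norm_inv_mul_add_one_le (by linarith)
      _ = _ := by rw [hexp]; ring
  have hGd : DifferentiableOn ℂ G {s | 1 / 2 + δ ≤ s.re ∧ s.re ≤ 2} := by
    refine (hFd.mono fun s hs => ?_).mul (DifferentiableOn.mul ?_ (DifferentiableOn.inv ?_ ?_))
    · have := hs.1
      rw [Set.mem_ofPred_eq]
      linarith
    · exact (differentiable_id.const_cpow (.inl hxc)).differentiableOn
    · fun_prop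
    · exact fun s hs => ne_zero_of_half_le_re (by linarith [hs.1])
  have hshift := integral_vertical_line_eq (G := G) (σ₁ := 1 / 2 + δ) (σ₂ := 2)
    (B := 18 * C * (N : ℝ) ^ η * x ^ (2 : ℝ)) (r := 3 / 2) (by linarith) (by norm_num) hGd
    fun s h1 h2 => (hGb s h1 h2).trans (by gcongr)
  have hperron := integral_LSeries_mul_eq_sum
    (a := fun n => χ n * (ArithmeticFunction.moebius n : ℂ)) (fun n => by
      rw [norm_mul]
      refine mul_le_one₀ (χ.norm_le_one _) (norm_nonneg _) ?_
      rw [Complex.norm_intCast]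
      exact_mod_cast ArithmeticFunction.abs_moebius_le_one) hx0
  have heq : ∫ y : ℝ, G ((2 : ℝ) + y * Complex.I) = 2 * Real.pi *
      ∑ n ∈ Icc 1 ⌊x⌋₊, χ n * (ArithmeticFunction.moebius n : ℂ) * (1 - n / x) := by
    rw [← hperron]
    congr 1
    ext y
    simp only [hG]
    rw [hFL _ (by simp)]
  have hle : ‖∫ y : ℝ, G ((1 / 2 + δ : ℝ) + y * Complex.I)‖ ≤
      18 * C * (N : ℝ) ^ η * x ^ (1 / 2 + δ) * J := by
    rw [hJ, ← MeasureTheory.integral_const_mul]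
    refine MeasureTheory.norm_integral_le_of_norm_le
      ((integrable_one_add_abs_rpow (by norm_num)).const_mul _) (Eventually.of_forall fun y => ?_)
    have hre : (((1 / 2 + δ : ℝ) : ℂ) + y * Complex.I).re = 1 / 2 + δ := by simp
    have him : (((1 / 2 + δ : ℝ) : ℂ) + y * Complex.I).im = y := by simp
    have := hGb ((1 / 2 + δ : ℝ) + y * Complex.I) hre.ge (by rw [hre]; linarith)
    rwa [hre, him] at this
  rw [hshift, heq, norm_mul] at hle
  have hpi : (1 : ℝ) ≤ ‖(2 * Real.pi : ℂ)‖ := by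
    rw [norm_mul, Complex.norm_real, Real.norm_of_nonneg Real.pi_pos.le]
    norm_num
    linarith [Real.pi_gt_three]
  have hsum : ∑ n ∈ Icc 1 ⌊x⌋₊, χ n * (ArithmeticFunction.moebius n : ℂ) * (x - n) =
      x * ∑ n ∈ Icc 1 ⌊x⌋₊, χ n * (ArithmeticFunction.moebius n : ℂ) * (1 - n / x) := by
    rw [mul_sum]
    refine sum_congr rfl fun n _ => ?_
    field_simp
  rw [hsum, norm_mul, Complex.norm_real, Real.norm_of_nonneg hx0.le]
  calc _ ≤ x * (18 * C * (N : ℝ) ^ η * x ^ (1 / 2 + δ) * J) := by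
        gcongr
        exact (le_mul_of_one_le_left (norm_nonneg _) hpi).trans hle
    _ ≤ x * (18 * C * (N : ℝ) ^ η * x ^ (1 / 2 + δ) * (J + 1)) := by gcongr; linarith
    _ = 18 * C * (J + 1) * (N : ℝ) ^ η * (x ^ (1 : ℝ) * x ^ (1 / 2 + δ)) := by
        rw [Real.rpow_one]; ring
    _ = _ := by
        rw [← Real.rpow_add hx0]
        ring_nf

/-- A Tauberian step: bounds for the Cesàro means of a bounded sequence give bounds for its
partial sums. -/
theorem norm_sum_le_of_norm_sum_mul_sub_le {a : ℕ → ℂ} (ha : ∀ n, ‖a n‖ ≤ 1) {K δ : ℝ}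
    (hK : 0 ≤ K) (hδ : 0 < δ) (hδ' : δ ≤ 3 / 2)
    (h : ∀ x : ℝ, 1 ≤ x → ‖∑ n ∈ Icc 1 ⌊x⌋₊, a n * (x - n)‖ ≤ K * x ^ (3 / 2 + δ))
    {z : ℝ} (hz : 1 ≤ z) :
    ‖∑ n ∈ Icc 1 ⌊z⌋₊, a n‖ ≤ 9 * K * z ^ (3 / 4 + δ) + 2 * z ^ (3 / 4 : ℝ) := by
  have hz0 : 0 < z := by linarith
  set w : ℝ := z ^ (3 / 4 : ℝ) with hw
  have hw1 : 1 ≤ w := Real.one_le_rpow hz (by norm_num)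
  have hwz : w ≤ z := by
    calc w ≤ z ^ (1 : ℝ) := Real.rpow_le_rpow_of_exponent_le hz (by norm_num)
      _ = z := Real.rpow_one z
  have hfl : ⌊z⌋₊ ≤ ⌊z + w⌋₊ := Nat.floor_mono (by linarith)
  have hsplit : ∑ n ∈ Icc 1 ⌊z + w⌋₊, a n * ((z + w : ℝ) - n) =
      ∑ n ∈ Icc 1 ⌊z⌋₊, a n * ((z + w : ℝ) - n) +
      ∑ n ∈ Ioc ⌊z⌋₊ ⌊z + w⌋₊, a n * ((z + w : ℝ) - n) := by
    rw [← sum_union]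
    · congr 1
      ext n
      simp only [mem_union, mem_Icc, mem_Ioc]
      omega
    · rw [disjoint_left]
      intro n h1 h2
      simp only [mem_Icc, mem_Ioc] at h1 h2
      omega
  have heq : (w : ℂ) * ∑ n ∈ Icc 1 ⌊z⌋₊, a n =
      ∑ n ∈ Icc 1 ⌊z + w⌋₊, a n * ((z + w : ℝ) - n) - ∑ n ∈ Icc 1 ⌊z⌋₊, a n * (z - n) -
      ∑ n ∈ Ioc ⌊z⌋₊ ⌊z + w⌋₊, a n * ((z + w : ℝ) - n) := by
    rw [hsplit, mul_sum, add_sub_right_comm, add_sub_cancel_right, ← sum_sub_distrib]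
    refine sum_congr rfl fun n _ => ?_
    push_cast
    ring
  have hshort : ‖∑ n ∈ Ioc ⌊z⌋₊ ⌊z + w⌋₊, a n * ((z + w : ℝ) - n)‖ ≤ 2 * w * w := by
    calc _ ≤ ∑ n ∈ Ioc ⌊z⌋₊ ⌊z + w⌋₊, w := by
          refine norm_sum_le_of_le _ fun n hn => ?_
          obtain ⟨h1, h2⟩ := mem_Ioc.1 hn
          have h3 := (Nat.floor_lt hz0.le).1 h1
          have h4 := (Nat.le_floor_iff (by positivity)).1 h2
          rw [norm_mul, ← Complex.ofReal_natCast, ← Complex.ofReal_sub, Complex.norm_real,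
            Real.norm_of_nonneg (by linarith)]
          calc ‖a n‖ * (z + w - n) ≤ 1 * w := by
                gcongr
                · exact ha n
                · linarith
            _ = w := one_mul w
      _ = (⌊z + w⌋₊ - ⌊z⌋₊ : ℝ) * w := by
          rw [sum_const, Nat.card_Ioc, nsmul_eq_mul, Nat.cast_sub hfl]
      _ ≤ 2 * w * w := by
          gcongr
          have := Nat.floor_le (by positivity : 0 ≤ z + w)
          have := Nat.lt_floor_add_one z
          linarith
  have hbig : ‖∑ n ∈ Icc 1 ⌊z + w⌋₊, a n * ((z + w : ℝ) - n)‖ ≤ 8 * K * z ^ (3 / 2 + δ) := by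
    calc _ ≤ K * (z + w) ^ (3 / 2 + δ) := h (z + w) (by linarith)
      _ ≤ K * (2 * z) ^ (3 / 2 + δ) := by gcongr; linarith
      _ = K * ((2 : ℝ) ^ (3 / 2 + δ) * z ^ (3 / 2 + δ)) := by
          rw [Real.mul_rpow (by norm_num) hz0.le]
      _ ≤ K * ((2 : ℝ) ^ (3 : ℝ) * z ^ (3 / 2 + δ)) := by
          gcongr
          · norm_num
          · linarith
      _ = _ := by norm_num; ring
  have hnorm : w * ‖∑ n ∈ Icc 1 ⌊z⌋₊, a n‖ ≤
      w * (9 * K * z ^ (3 / 4 + δ) + 2 * w) := by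
    have hpow : z ^ (3 / 2 + δ) = w * z ^ (3 / 4 + δ) := by
      rw [hw, ← Real.rpow_add hz0]
      ring_nf
    calc w * ‖∑ n ∈ Icc 1 ⌊z⌋₊, a n‖ = ‖(w : ℂ) * ∑ n ∈ Icc 1 ⌊z⌋₊, a n‖ := by
          rw [norm_mul, Complex.norm_real, Real.norm_of_nonneg (by linarith)]
      _ ≤ 8 * K * z ^ (3 / 2 + δ) + K * z ^ (3 / 2 + δ) + 2 * w * w := by
          rw [heq]
          exact (norm_sub_le _ _).trans (add_le_add ((norm_sub_le _ _).trans
            (add_le_add hbig (h z hz))) hshort)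
      _ = _ := by rw [hpow]; ring
  exact le_of_mul_le_mul_left hnorm (by linarith)

/-- Partial sums of `χ μ` under GRH, uniformly for moduli up to the length of the sum. -/
theorem exists_norm_sum_moebius_le
    (GRH : ∀ (N : ℕ) [NeZero N] (χ : DirichletCharacter ℂ N) (s : ℂ),
      DirichletCharacter.LFunction χ s = 0 → 0 < s.re → s.re < 1 → s.re = 1 / 2)
    {ε : ℝ} (hε : 0 < ε) :
    ∃ C : ℝ, 0 < C ∧ ∀ (N : ℕ) [NeZero N] (χ : DirichletCharacter ℂ N) (z : ℝ), 1 ≤ z →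
      (N : ℝ) ≤ z → ‖∑ n ∈ Icc 1 ⌊z⌋₊, χ n * (ArithmeticFunction.moebius n : ℂ)‖ ≤
        C * z ^ (3 / 4 + ε) := by
  set δ : ℝ := min (ε / 2) (1 / 2) with hδ
  have hδ0 : 0 < δ := by positivity
  have hδ1 : δ ≤ 1 / 2 := min_le_right _ _
  have hδε : δ ≤ ε / 2 := min_le_left _ _
  obtain ⟨C, hC, h⟩ := exists_norm_sum_mul_sub_le GRH hδ0 (by linarith) hδ0 hδ1
  refine ⟨9 * C + 2, by positivity, fun N _ χ z hz hN => ?_⟩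
  have hz0 : 0 < z := by linarith
  refine (norm_sum_le_of_norm_sum_mul_sub_le (fun n => ?_) (by positivity) hδ0 (by linarith)
    (h N χ) hz).trans ?_
  · rw [norm_mul]
    refine mul_le_one₀ (χ.norm_le_one _) (norm_nonneg _) ?_
    rw [Complex.norm_intCast]
    exact_mod_cast ArithmeticFunction.abs_moebius_le_one
  · have h1 : (N : ℝ) ^ δ * z ^ (3 / 4 + δ) ≤ z ^ (3 / 4 + ε) := by
      calc (N : ℝ) ^ δ * z ^ (3 / 4 + δ) ≤ z ^ δ * z ^ (3 / 4 + δ) := by gcongr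
        _ = z ^ (δ + (3 / 4 + δ)) := (Real.rpow_add hz0 _ _).symm
        _ ≤ z ^ (3 / 4 + ε) := Real.rpow_le_rpow_of_exponent_le hz (by linarith)
    have h2 : z ^ (3 / 4 : ℝ) ≤ z ^ (3 / 4 + ε) :=
      Real.rpow_le_rpow_of_exponent_le hz (by linarith)
    calc _ = 9 * C * ((N : ℝ) ^ δ * z ^ (3 / 4 + δ)) + 2 * z ^ (3 / 4 : ℝ) := by ring
      _ ≤ 9 * C * z ^ (3 / 4 + ε) + 2 * z ^ (3 / 4 + ε) := by gcongr
      _ = _ := by ring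

theorem ZMod.sum_units_mul_sum_filter {q : ℕ} [NeZero q] (s : Finset ℕ) (b : ℕ → ℂ)
    {g : ZMod q → ℂ} (hg : ∀ a, ¬ IsUnit a → g a = 0) :
    ∑ u : (ZMod q)ˣ, g u * ∑ n ∈ s with ((n : ℕ) : ZMod q) = u, b n = ∑ n ∈ s, g n * b n := by
  simp_rw [mul_sum, sum_filter]
  rw [sum_comm]
  refine sum_congr rfl fun n _ => ?_
  by_cases hn : IsUnit (n : ZMod q)
  · obtain ⟨v, hv⟩ := hn
    rw [sum_eq_single v]
    · rw [if_pos hv.symm, hv]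
    · intro u _ huv
      refine if_neg fun h => huv ?_
      rw [← hv] at h
      exact (Units.ext h).symm
    · simp
  · rw [hg _ hn, zero_mul]
    exact sum_eq_zero fun u _ => by
      simp_rw [show (n : ZMod q) ≠ u from fun h => hn (h ▸ u.isUnit), if_false]

/-- Plancherel's identity for the Dirichlet characters modulo `q`. -/
theorem DirichletCharacter.sum_norm_sq_eq {q : ℕ} [NeZero q] (T : (ZMod q)ˣ → ℂ) :
    ∑ χ : DirichletCharacter ℂ q, ‖∑ u : (ZMod q)ˣ, χ u * T u‖ ^ 2 =
      q.totient * ∑ u : (ZMod q)ˣ, ‖T u‖ ^ 2 := by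
  have hconj : ∀ (χ : DirichletCharacter ℂ q) (u : (ZMod q)ˣ),
      (starRingEnd ℂ) (χ u) = χ ((u : ZMod q)⁻¹) := by
    intro χ u
    exact (MulChar.star_apply' χ u).trans <|
      (MulChar.inv_apply χ u).trans (by rw [Ring.inverse_unit, ZMod.inv_coe_unit])
  have : (((∑ χ : DirichletCharacter ℂ q, ‖∑ u : (ZMod q)ˣ, χ u * T u‖ ^ 2 : ℝ)) : ℂ) =
      ((q.totient * ∑ u : (ZMod q)ˣ, ‖T u‖ ^ 2 : ℝ) : ℂ) := by
    push_cast
    simp_rw [← Complex.conj_mul', map_sum, map_mul, sum_mul_sum]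
    rw [sum_comm, mul_sum]
    refine sum_congr rfl fun u _ => ?_
    rw [sum_comm]
    have hv : ∀ v : (ZMod q)ˣ, ∑ χ : DirichletCharacter ℂ q,
        (starRingEnd ℂ) (χ u) * (starRingEnd ℂ) (T u) * (χ v * T v) =
        (if u = v then (q.totient : ℂ) else 0) * ((starRingEnd ℂ) (T u) * T v) := by
      intro v
      have h := DirichletCharacter.sum_char_inv_mul_char_eq ℂ u.isUnit (v : ZMod q)
      simp only [Units.val_inj] at h
      rw [← h, sum_mul]
      refine sum_congr rfl fun χ _ => ?_
      rw [hconj]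
      ring
    simp_rw [hv, ite_mul, zero_mul]
    simp
  exact_mod_cast this

/-- A sum twisted by a bounded function on the reduced residues modulo `q` is controlled by the
sums twisted by the Dirichlet characters modulo `q`. -/
theorem norm_sum_coprime_mul_le {q : ℕ} [NeZero q] (s : Finset ℕ) (b : ℕ → ℂ) {g : ZMod q → ℂ}
    (hg : ∀ a, ‖g a‖ ≤ 1) {K : ℝ} (hK : 0 ≤ K)
    (h : ∀ χ : DirichletCharacter ℂ q, ‖∑ n ∈ s, χ n * b n‖ ≤ K) :
    ‖∑ n ∈ s with Nat.gcd n q = 1, b n * g n‖ ≤ (q : ℝ) ^ (1 / 2 : ℝ) * K := by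
  classical
  set T : (ZMod q)ˣ → ℂ := fun u => ∑ n ∈ s with ((n : ℕ) : ZMod q) = u, b n with hT
  have hS : ∑ n ∈ s with Nat.gcd n q = 1, b n * g n = ∑ u : (ZMod q)ˣ, g u * T u := by
    have := ZMod.sum_units_mul_sum_filter s b (q := q)
      (g := fun a => if IsUnit a then g a else 0) (fun a ha => if_neg ha)
    simp only [Units.isUnit, if_true] at this
    rw [hT, this, sum_filter]
    refine sum_congr rfl fun n _ => ?_
    have : IsUnit (n : ZMod q) ↔ Nat.gcd n q = 1 := ZMod.isUnit_iff_coprime n q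
    rw [ite_mul, zero_mul, mul_comm (g n)]
    simp only [this]
  have hM : ∀ χ : DirichletCharacter ℂ q, ∑ u : (ZMod q)ˣ, χ u * T u = ∑ n ∈ s, χ n * b n :=
    fun χ => ZMod.sum_units_mul_sum_filter s b fun a ha => χ.map_nonunit ha
  have hsq : ‖∑ u : (ZMod q)ˣ, g u * T u‖ ^ 2 ≤ q * K ^ 2 := by
    calc ‖∑ u : (ZMod q)ˣ, g u * T u‖ ^ 2 ≤ (∑ u : (ZMod q)ˣ, ‖T u‖) ^ 2 := by
          gcongr
          refine norm_sum_le_of_le _ fun u _ => ?_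
          rw [norm_mul]
          exact mul_le_of_le_one_left (norm_nonneg _) (hg _)
      _ ≤ q.totient * ∑ u : (ZMod q)ˣ, ‖T u‖ ^ 2 := by
          have := sq_sum_le_card_mul_sum_sq (s := univ) (f := fun u : (ZMod q)ˣ => ‖T u‖)
          rwa [card_univ, ZMod.card_units_eq_totient] at this
      _ = ∑ χ : DirichletCharacter ℂ q, ‖∑ n ∈ s, χ n * b n‖ ^ 2 := by
          simp_rw [← DirichletCharacter.sum_norm_sq_eq, hM]
      _ ≤ ∑ χ : DirichletCharacter ℂ q, K ^ 2 := by
          gcongr with χ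
          exact h χ
      _ = q.totient * K ^ 2 := by
          rw [sum_const, nsmul_eq_mul, card_univ, ← Nat.card_eq_fintype_card,
            DirichletCharacter.card_eq_totient_of_hasEnoughRootsOfUnity]
      _ ≤ q * K ^ 2 := by
          gcongr
          exact Nat.totient_le q
  rw [hS, ← Real.sqrt_eq_rpow]
  refine abs_le_of_sq_le_sq' ?_ (by positivity) |>.2
  rwa [mul_pow, Real.sq_sqrt (by positivity)]

theorem norm_eFun (x : ℝ) : ‖eFun x‖ = 1 := by
  rw [eFun, show 2 * Real.pi * Complex.I * x = ((2 * Real.pi * x : ℝ) : ℂ) * Complex.I by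
    push_cast; ring, Complex.norm_exp_ofReal_mul_I]

/-- **Lemma.** Assuming the Generalized Riemann Hypothesis for all Dirichlet `L`-functions,
for every `ε > 0` there is `C` such that for all `q ≥ 2`, `t ∈ ℤ` and `z ≥ 1`,
`|Σ_{n ≤ z, (n,q)=1} μ(n) e(t·n̄_q/q)| ≤ C z^{3/4+ε} q^{1/2} τ(q)²`, where `n̄_q` is the
inverse of `n` modulo `q` (realized via `ZMod q`). -/
theorem moebius_twisted_expSum_GRH
    (GRH : ∀ (N : ℕ) [NeZero N] (χ : DirichletCharacter ℂ N) (s : ℂ),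
      DirichletCharacter.LFunction χ s = 0 → 0 < s.re → s.re < 1 → s.re = 1 / 2) :
    ∀ ε : ℝ, 0 < ε → ∃ C : ℝ, 0 < C ∧
      ∀ q : ℕ, 2 ≤ q → ∀ t : ℤ, ∀ z : ℝ, 1 ≤ z →
        norm
            (∑ n ∈ (Finset.Icc 1 (Nat.floor z)).filter (fun n : ℕ => Nat.gcd n q = 1),
              (ArithmeticFunction.moebius n : ℂ) *
                eFun ((t : ℝ) * ((((n : ZMod q)⁻¹).val : ℕ) : ℝ) / (q : ℝ))) ≤
          C * z ^ ((3 : ℝ) / 4 + ε) * (q : ℝ) ^ ((1 : ℝ) / 2) *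
            (q.divisors.card : ℝ) ^ 2 := by
  intro ε hε
  obtain ⟨C, hC, hM⟩ := exists_norm_sum_moebius_le GRH hε
  refine ⟨C + 1, by positivity, fun q hq t z hz => ?_⟩
  have : NeZero q := ⟨by omega⟩
  have hz0 : 0 < z := by linarith
  have hdiv : (1 : ℝ) ≤ (q.divisors.card : ℝ) ^ 2 := by
    refine one_le_pow₀ ?_
    exact_mod_cast card_pos.2 (Nat.nonempty_divisors.2 (NeZero.ne q))
  refine le_trans ?_ (le_mul_of_one_le_right (by positivity) hdiv)
  rcases le_total (q : ℝ) z with hqz | hqz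
  · calc _ ≤ (q : ℝ) ^ (1 / 2 : ℝ) * (C * z ^ (3 / 4 + ε)) :=
          norm_sum_coprime_mul_le (Icc 1 ⌊z⌋₊) (fun n => (ArithmeticFunction.moebius n : ℂ))
            (g := fun a : ZMod q => eFun ((t : ℝ) * (((a⁻¹).val : ℕ) : ℝ) / (q : ℝ)))
            (fun a => (norm_eFun _).le) (by positivity) fun χ => hM q χ z hz hqz
      _ = C * z ^ (3 / 4 + ε) * (q : ℝ) ^ (1 / 2 : ℝ) := by ring
      _ ≤ _ := by gcongr; linarith
  · calc _ ≤ ∑ n ∈ Icc 1 ⌊z⌋₊ with Nat.gcd n q = 1, (1 : ℝ) := by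
          refine norm_sum_le_of_le _ fun n _ => ?_
          rw [norm_mul, norm_eFun, mul_one, Complex.norm_intCast]
          exact_mod_cast ArithmeticFunction.abs_moebius_le_one
      _ ≤ ∑ n ∈ Icc 1 ⌊z⌋₊, (1 : ℝ) := sum_le_sum_of_subset_of_nonneg (filter_subset _ _)
          fun _ _ _ => zero_le_one
      _ ≤ z := by
          rw [sum_const, Nat.card_Icc, nsmul_eq_mul, mul_one, Nat.add_sub_cancel]
          exact Nat.floor_le hz0.le
      _ = z ^ (1 / 2 : ℝ) * z ^ (1 / 2 : ℝ) := by
          rw [← Real.rpow_add hz0]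
          norm_num
      _ ≤ z ^ (3 / 4 + ε) * (q : ℝ) ^ (1 / 2 : ℝ) := by
          gcongr
          linarith
      _ ≤ (C + 1) * z ^ (3 / 4 + ε) * (q : ℝ) ^ (1 / 2 : ℝ) := by
          gcongr
          exact le_mul_of_one_le_left (by positivity) (by linarith)
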